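/- Let K be a field and let p, q ∈ K with p ≠ q. For every c ∈ K with c ≠ 0, let f = c·(X − p)/(X − q) ∈ RatFunc K. Then the derivative of f evaluated at p, multiplied by the derivative of 1/f evaluated at q, equals −1/(p − q)²; in particular this product is independent of c. Explicitly, f′(p) = c/(p − q), (1/f)′(q) = 1/(c·(q − p)), and f′(p)·(1/f)′(q) = −(p − q)^{-2}. -/

import Mathlib

/-!
STATEMENT 16: Let K be a field, p ≠ q ∈ K, and for c ∈ K, c ≠ 0, let
f = c·(X − p)/(X − q) ∈ RatFunc K.  Then f′(p) = c/(p − q),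
(1/f)′(q) = 1/(c·(q − p)), and f′(p)·(1/f)′(q) = −(p − q)⁻²; in particular the
product is independent of c.  Derivatives are formal derivatives of rational
functions, computed by the quotient rule from the formal derivative of polynomials.
-/

open Polynomial

noncomputable section

/-- The formal derivative of a rational function, computed by the quotient rule
from the formal derivative of polynomials, using the canonical numerator and
denominator. -/
def ratDeriv {K : Type*} [Field K] (f : RatFunc K) : RatFunc K :=
  algebraMap (Polynomial K) (RatFunc K)
      (Polynomial.derivative f.num * f.denom - f.num * Polynomial.derivative f.denom) /
    algebraMap (Polynomial K) (RatFunc K) (f.denom ^ 2)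

theorem RatFunc.eval_denom_div_ne_zero {K : Type*} [Field K] (a : K[X]) {b : K[X]} {x : K}
    (hb : b.eval x ≠ 0) :
    (RatFunc.denom (algebraMap K[X] (RatFunc K) a / algebraMap K[X] (RatFunc K) b)).eval x ≠ 0 :=
  fun h => hb (eval_eq_zero_of_dvd_of_eval_eq_zero (RatFunc.denom_div_dvd a b) h)

theorem RatFunc.num_mul_eq_mul_denom_div {K : Type*} [Field K] (a : K[X]) {b : K[X]}
    (hb : b ≠ 0) :
    (RatFunc.num (algebraMap K[X] (RatFunc K) a / algebraMap K[X] (RatFunc K) b)) * b =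
      a * (RatFunc.denom (algebraMap K[X] (RatFunc K) a / algebraMap K[X] (RatFunc K) b)) :=
  (RatFunc.num_mul_eq_mul_denom_iff hb).2 rfl

theorem RatFunc.eval_div_algebraMap {K : Type*} [Field K] (a : K[X]) {b : K[X]} {x : K}
    (hb : b.eval x ≠ 0) :
    RatFunc.eval (RingHom.id K) x
      (algebraMap K[X] (RatFunc K) a / algebraMap K[X] (RatFunc K) b) = a.eval x / b.eval x := by
  have hb0 : b ≠ 0 := by rintro rfl; simp at hb
  have hd := RatFunc.eval_denom_div_ne_zero a hb
  have h := congrArg (Polynomial.eval x) (RatFunc.num_mul_eq_mul_denom_div a hb0)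
  rw [Polynomial.eval_mul, Polynomial.eval_mul] at h
  change Polynomial.eval x _ / Polynomial.eval x _ = _
  rw [div_eq_div_iff hd hb, h]

/-- The quotient rule for `ratDeriv` holds, pointwise, for any representation as a fraction. -/
theorem eval_ratDeriv_div {K : Type*} [Field K] (a : K[X]) {b : K[X]} {x : K}
    (hb : b.eval x ≠ 0) :
    RatFunc.eval (RingHom.id K) x
      (ratDeriv (algebraMap K[X] (RatFunc K) a / algebraMap K[X] (RatFunc K) b)) =
      ((derivative a).eval x * b.eval x - a.eval x * (derivative b).eval x) / b.eval x ^ 2 := by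
  have hb0 : b ≠ 0 := by rintro rfl; simp at hb
  have hd := RatFunc.eval_denom_div_ne_zero a hb
  have h := RatFunc.num_mul_eq_mul_denom_div a hb0
  rw [ratDeriv, RatFunc.eval_div_algebraMap _ (by simpa using hd)]
  generalize RatFunc.num (algebraMap K[X] (RatFunc K) a / algebraMap K[X] (RatFunc K) b) = n at *
  generalize RatFunc.denom (algebraMap K[X] (RatFunc K) a / algebraMap K[X] (RatFunc K) b) = d at *
  have h₀ := congrArg (Polynomial.eval x) h
  have h₁ := congrArg (fun r => (derivative r).eval x) h
  simp only [derivative_mul, Polynomial.eval_mul, Polynomial.eval_add] at h₀ h₁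
  simp only [Polynomial.eval_sub, Polynomial.eval_mul, Polynomial.eval_pow]
  rw [div_eq_div_iff (pow_ne_zero 2 hd) (pow_ne_zero 2 hb)]
  linear_combination (b.eval x * d.eval x) * h₁ -
    (b.eval x * (derivative d).eval x + d.eval x * (derivative b).eval x) * h₀

theorem transport_tensor_computation
    (K : Type*) [Field K] (p q c : K) (hpq : p ≠ q) (hc : c ≠ 0)
    (f : RatFunc K)
    (hf : f = RatFunc.C c * ((RatFunc.X - RatFunc.C p) / (RatFunc.X - RatFunc.C q))) :
    RatFunc.eval (RingHom.id K) p (ratDeriv f) = c / (p - q) ∧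
    RatFunc.eval (RingHom.id K) q (ratDeriv (1 / f)) = 1 / (c * (q - p)) ∧
    RatFunc.eval (RingHom.id K) p (ratDeriv f) *
        RatFunc.eval (RingHom.id K) q (ratDeriv (1 / f)) = -(p - q)⁻¹ ^ 2 := by
  have hpq' : p - q ≠ 0 := sub_ne_zero.2 hpq
  have hqp' : q - p ≠ 0 := sub_ne_zero.2 hpq.symm
  have hf₁ : f = algebraMap K[X] (RatFunc K) (C c * (X - C p)) /
      algebraMap K[X] (RatFunc K) (X - C q) := by
    rw [hf, map_mul, map_sub, map_sub, RatFunc.algebraMap_X, RatFunc.algebraMap_C,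
      RatFunc.algebraMap_C, RatFunc.algebraMap_C, mul_div_assoc]
  have hf₂ : 1 / f = algebraMap K[X] (RatFunc K) (X - C q) /
      algebraMap K[X] (RatFunc K) (C c * (X - C p)) := by
    rw [hf₁, one_div_div]
  have h₁ : RatFunc.eval (RingHom.id K) p (ratDeriv f) = c / (p - q) := by
    rw [hf₁, eval_ratDeriv_div _ (by simpa using hpq')]
    simp
    field_simp
  have h₂ : RatFunc.eval (RingHom.id K) q (ratDeriv (1 / f)) = 1 / (c * (q - p)) := by
    rw [hf₂, eval_ratDeriv_div _ (by simpa using ⟨hc, hqp'⟩)]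
    simp
    field_simp
  refine ⟨h₁, h₂, ?_⟩
  rw [h₁, h₂, ← neg_sub p q]
  field_simp
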